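/- Let N ≥ 1, let γ > 0, and let α₁, …, α_{N+1} be nonnegative reals with α₁ + ⋯ + α_{N+1} = 1 and α_{N+1} < 1. Setting s = 1 − α_{N+1} and α̃ᵢ = αᵢ / s for 1 ≤ i ≤ N, the expression s·∑_{i=1}^{N} α̃ᵢ·log α̃ᵢ + s·log s + (1/γ)·log s equals 0 if and only if there exists j with 1 ≤ j ≤ N such that α_j = 1 (which forces α_{N+1} = 0 and αₖ = 0 for all k ≠ j). -/

import Mathlib

/-- Attainment part of Proposition 2: with `γ > 0`, the augmented objective
`s·∑ α̃ᵢ log α̃ᵢ + s log s + (1/γ)·log s` equals `0` iff one of the first `N`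
coordinates equals `1` (convention `0 · log 0 = 0`). -/
theorem stmt_5 (N : ℕ) (hN : 1 ≤ N) (γ : ℝ) (hγ : 0 < γ)
    (α : Fin (N + 1) → ℝ)
    (hnonneg : ∀ i, 0 ≤ α i) (hsum : ∑ i, α i = 1)
    (hlast : α (Fin.last N) < 1) :
    (1 - α (Fin.last N)) *
        (∑ i : Fin N, (α i.castSucc / (1 - α (Fin.last N))) *
          Real.log (α i.castSucc / (1 - α (Fin.last N))))
      + (1 - α (Fin.last N)) * Real.log (1 - α (Fin.last N))
      + (1 / γ) * Real.log (1 - α (Fin.last N)) = 0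
    ↔ ∃ j : Fin N, α j.castSucc = 1 := by
  rw [Fin.sum_univ_castSucc] at hsum
  have hle : ∀ i : Fin N, α i.castSucc ≤ 1 - α (Fin.last N) := by
    intro i
    have := Finset.single_le_sum (f := fun i : Fin N => α i.castSucc)
      (fun i _ => hnonneg _) (Finset.mem_univ i)
    linarith
  have h0 := hnonneg (Fin.last N)
  generalize hs : 1 - α (Fin.last N) = s at *
  have hs0 : 0 < s := by linarith
  have hs1 : s ≤ 1 := by linarith
  have hterm : ∀ i : Fin N, (α i.castSucc / s) * Real.log (α i.castSucc / s) ≤ 0 := by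
    intro i
    have h1 : 0 ≤ α i.castSucc / s := div_nonneg (hnonneg _) hs0.le
    have h2 : α i.castSucc / s ≤ 1 := (div_le_one hs0).2 (hle i)
    exact mul_nonpos_of_nonneg_of_nonpos h1 (Real.log_nonpos h1 h2)
  have hlog : Real.log s ≤ 0 := Real.log_nonpos hs0.le hs1
  constructor
  · intro h
    have hS := Finset.sum_nonpos (fun i (_ : i ∈ Finset.univ) => hterm i)
    have h1 := mul_nonpos_of_nonneg_of_nonpos hs0.le hS
    have h2 := mul_nonpos_of_nonneg_of_nonpos hs0.le hlog
    have hg : 0 < 1 / γ := by positivity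
    have h3 := mul_nonpos_of_nonneg_of_nonpos hg.le hlog
    have h4 : Real.log s = 0 := by
      have : (1 / γ) * Real.log s = 0 := by linarith
      exact (mul_eq_zero.1 this).resolve_left hg.ne'
    have h5 : s = 1 := Real.eq_one_of_pos_of_log_eq_zero hs0 h4
    subst h5
    have h6 : ∑ i : Fin N, (α i.castSucc / 1) * Real.log (α i.castSucc / 1) = 0 := by
      rw [h4] at h
      linarith
    rw [Finset.sum_eq_zero_iff_of_nonpos (fun i _ => hterm i)] at h6
    by_contra hne
    push Not at hne
    have h7 : ∀ i : Fin N, α i.castSucc = 0 := by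
      intro i
      have h8 := h6 i (Finset.mem_univ i)
      rw [div_one] at h8
      rcases mul_eq_zero.1 h8 with h | h
      · exact h
      · by_contra hn
        exact hne i (Real.eq_one_of_pos_of_log_eq_zero
          (lt_of_le_of_ne (hnonneg _) (Ne.symm hn)) h)
    simp only [h7, Finset.sum_const_zero] at hsum
    linarith
  · rintro ⟨j, hj⟩
    have h5 : s = 1 := le_antisymm hs1 (hj ▸ hle j)
    subst h5
    have hS : ∑ i : Fin N, α i.castSucc = 1 := by linarith
    have h7 : ∑ i : Fin N, (α i.castSucc / 1) * Real.log (α i.castSucc / 1) = 0 := by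
      refine Finset.sum_eq_zero fun i _ => ?_
      rw [div_one]
      by_cases hij : i = j
      · simp [hij, hj]
      · have h9 := Finset.add_le_sum (f := fun i : Fin N => α i.castSucc)
          (fun i _ => hnonneg _) (Finset.mem_univ i) (Finset.mem_univ j) hij
        have : α i.castSucc = 0 := le_antisymm (by linarith) (hnonneg _)
        simp [this]
    rw [h7]
    simp
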